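/- arXiv:2201.07650 — 3 statements merged into one kernel-verified Lean document; each statement's English description precedes it below -/
import Mathlib

section
/- There exists a universal constant C > 0 with the following property. Let b ≥ 3, let λ⁺ = (−b + √(b²−4))/2 and λ⁻ = (−b − √(b²−4))/2, let a₀ ∈ ℂ, and let f : [0,∞) → ℂ be continuous with ∫₀^∞ |f(s)| ds < ∞. Define d(t) := (λ⁺ − λ⁻)⁻¹ [ a₀ (e^{λ⁺t} − e^{λ⁻t}) + ∫₀ᵗ f(s)(e^{λ⁺(t−s)} − e^{λ⁻(t−s)}) ds ]. Then ∫₀^∞ |d(t)| dt ≤ C ( |a₀| + ∫₀^∞ |f(s)| ds ), with C independent of b, a₀ and f. -/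
open MeasureTheory

/-- The nonnegative part of the impulse response of the operator `(∂ₜ - p) (∂ₜ - m)`; it vanishes on
the negative half-line when `m < p`. -/
noncomputable def impulseResponse (p m u : ℝ) : ENNReal :=
  ENNReal.ofReal ((Real.exp (p * u) - Real.exp (m * u)) / (p - m))

lemma measurable_impulseResponse (p m : ℝ) : Measurable (impulseResponse p m) := by
  unfold impulseResponse
  fun_prop

lemma impulseResponse_of_nonpos {p m u : ℝ} (h : m < p) (hu : u ≤ 0) :
    impulseResponse p m u = 0 := by
  refine ENNReal.ofReal_of_nonpos (div_nonpos_of_nonpos_of_nonneg ?_ (sub_pos.2 h).le)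
  exact sub_nonpos.2 (Real.exp_le_exp.2 (mul_le_mul_of_nonpos_right h.le hu))

lemma impulseResponse_of_nonneg {p m u : ℝ} (h : m < p) (hu : 0 ≤ u) :
    impulseResponse p m u = ‖((p - m : ℝ) : ℂ)⁻¹‖ₑ *
      ‖Complex.exp ((p : ℂ) * (u : ℂ)) - Complex.exp ((m : ℂ) * (u : ℂ))‖ₑ := by
  have hsub : 0 ≤ Real.exp (p * u) - Real.exp (m * u) :=
    sub_nonneg.2 (Real.exp_le_exp.2 (mul_le_mul_of_nonneg_right h.le hu))
  have hcast : Complex.exp ((p : ℂ) * (u : ℂ)) - Complex.exp ((m : ℂ) * (u : ℂ)) =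
      ((Real.exp (p * u) - Real.exp (m * u) : ℝ) : ℂ) := by
    push_cast
    rfl
  rw [hcast, ← enorm_mul, ← Complex.ofReal_inv, ← Complex.ofReal_mul, ← ofReal_norm,
    Complex.norm_real, Real.norm_of_nonneg
      (mul_nonneg (inv_nonneg.2 (sub_pos.2 h).le) hsub), impulseResponse, div_eq_inv_mul]

lemma lintegral_Ioi_impulseResponse {p m : ℝ} (h : m < p) (hp : p < 0) :
    ∫⁻ u in Set.Ioi 0, impulseResponse p m u = ENNReal.ofReal (p * m)⁻¹ := by
  have hm : m < 0 := h.trans hp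
  have hpm : p - m ≠ 0 := (sub_pos.2 h).ne'
  have hip := integrableOn_exp_mul_Ioi hp 0
  have him := integrableOn_exp_mul_Ioi hm 0
  unfold impulseResponse
  rw [← ofReal_integral_eq_lintegral_ofReal]
  · rw [integral_div, integral_sub hip him, integral_exp_mul_Ioi hp, integral_exp_mul_Ioi hm]
    congr 1
    simp only [mul_zero, Real.exp_zero]
    field_simp [hp.ne, hm.ne]
    ring
  · exact (hip.sub him).div_const _
  · filter_upwards [self_mem_ae_restrict measurableSet_Ioi] with u hu
    exact div_nonneg (sub_nonneg.2 (Real.exp_le_exp.2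
      (mul_le_mul_of_nonneg_right h.le (le_of_lt hu)))) (sub_pos.2 h).le

lemma lintegral_impulseResponse {p m : ℝ} (h : m < p) (hp : p < 0) :
    ∫⁻ u, impulseResponse p m u = ENNReal.ofReal (p * m)⁻¹ := by
  rw [← lintegral_Ioi_impulseResponse h hp, ← lintegral_indicator measurableSet_Ioi]
  refine lintegral_congr fun u ↦ ?_
  by_cases hu : u ∈ Set.Ioi (0 : ℝ)
  · rw [Set.indicator_of_mem hu]
  · rw [Set.indicator_of_notMem hu, impulseResponse_of_nonpos h (not_lt.1 hu)]

/-- Tonelli's theorem for the convolution of two nonnegative functions, in which the first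
variable is restricted to a set. -/
lemma lintegral_setLIntegral_mul_comp_sub {F K : ℝ → ENNReal} {s : Set ℝ}
    (hF : AEMeasurable F (volume.restrict s)) (hK : Measurable K) :
    ∫⁻ t, ∫⁻ x in s, F x * K (t - x) = (∫⁻ x in s, F x) * ∫⁻ u, K u := by
  rw [lintegral_lintegral_swap]
  · have hinner (x : ℝ) : ∫⁻ t, F x * K (t - x) = F x * ∫⁻ u, K u := by
      rw [lintegral_const_mul _ (by fun_prop), lintegral_sub_right_eq_self K]
    simp_rw [hinner]
    exact lintegral_mul_const'' _ hF
  · exact hF.comp_snd.mul (hK.comp (measurable_fst.sub measurable_snd)).aemeasurable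

/-- Pointwise domination of the Duhamel formula by the impulse response. -/
lemma enorm_duhamel_le {p m t : ℝ} (h : m < p) (ht : 0 < t) (a : ℂ) (f : ℝ → ℂ) :
    ‖((p - m : ℝ) : ℂ)⁻¹ *
      (a * (Complex.exp ((p : ℂ) * (t : ℂ)) - Complex.exp ((m : ℂ) * (t : ℂ))) +
        ∫ s in (0:ℝ)..t,
          f s * (Complex.exp ((p : ℂ) * ((t - s : ℝ) : ℂ)) -
            Complex.exp ((m : ℂ) * ((t - s : ℝ) : ℂ))))‖ₑ ≤
      ‖a‖ₑ * impulseResponse p m t +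
        ∫⁻ s in Set.Ioi 0, ‖f s‖ₑ * impulseResponse p m (t - s) := by
  rw [mul_add, intervalIntegral.integral_of_le ht.le, ← integral_const_mul]
  refine (enorm_add_le _ _).trans (add_le_add (le_of_eq ?_) ?_)
  · rw [impulseResponse_of_nonneg h ht.le, enorm_mul, enorm_mul]
    ring
  · refine (enorm_integral_le_lintegral_enorm _).trans
      (le_trans (le_of_eq ?_) (lintegral_mono_set (Set.Ioc_subset_Ioi_self (a := t))))
    refine setLIntegral_congr_fun measurableSet_Ioc fun s hs ↦ ?_
    simp only [impulseResponse_of_nonneg h (sub_nonneg.2 hs.2), enorm_mul]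
    ring



/-- Mode-wise `L¹`-in-time estimate: there is a universal constant `C > 0` such
that for every `b ≥ 3`, with `λ⁺ = (-b + √(b²-4))/2`, `λ⁻ = (-b - √(b²-4))/2`,
every `a₀ ∈ ℂ` and every continuous integrable `f : [0,∞) → ℂ`, the solution
`d(t) = (λ⁺-λ⁻)⁻¹ [a₀(e^{λ⁺t} - e^{λ⁻t}) + ∫₀ᵗ f(s)(e^{λ⁺(t-s)} - e^{λ⁻(t-s)}) ds]`
satisfies `∫₀^∞ |d| ≤ C (|a₀| + ∫₀^∞ |f|)`. -/
theorem stmt_6 :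
    ∃ C : ℝ, 0 < C ∧
      ∀ (b lp lm : ℝ), 3 ≤ b →
        lp = (-b + Real.sqrt (b ^ 2 - 4)) / 2 →
        lm = (-b - Real.sqrt (b ^ 2 - 4)) / 2 →
        ∀ (a₀ : ℂ) (f : ℝ → ℂ),
          ContinuousOn f (Set.Ici 0) →
          IntegrableOn f (Set.Ioi 0) →
          ∀ dd : ℝ → ℂ,
            (∀ t : ℝ, dd t = (((lp - lm : ℝ)) : ℂ)⁻¹ *
              (a₀ * (Complex.exp ((lp : ℂ) * (t : ℂ)) - Complex.exp ((lm : ℂ) * (t : ℂ))) +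
                ∫ s in (0:ℝ)..t,
                  f s * (Complex.exp ((lp : ℂ) * ((t - s : ℝ) : ℂ)) -
                         Complex.exp ((lm : ℂ) * ((t - s : ℝ) : ℂ))))) →
            ∫⁻ t in Set.Ioi (0:ℝ), ENNReal.ofReal ‖dd t‖ ≤
              ENNReal.ofReal (C * (‖a₀‖ + ∫ s in Set.Ioi (0:ℝ), ‖f s‖)) := by
  refine ⟨1, one_pos, ?_⟩
  intro b lp lm hb hlp hlm a₀ f _ hf dd hdd
  have hsq : Real.sqrt (b ^ 2 - 4) ^ 2 = b ^ 2 - 4 := Real.sq_sqrt (by nlinarith)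
  have hpos : 0 < Real.sqrt (b ^ 2 - 4) := Real.sqrt_pos.2 (by nlinarith)
  have hlt : lm < lp := by linarith
  have hneg : lp < 0 := by
    have := abs_lt_of_sq_lt_sq (a := Real.sqrt (b ^ 2 - 4)) (b := b) (by linarith) (by linarith)
    linarith [(abs_lt.1 this).2]
  have hprod : lp * lm = 1 := by
    rw [hlp, hlm]
    linarith
  have hK : ∫⁻ u, impulseResponse lp lm u = 1 := by
    rw [lintegral_impulseResponse hlt hneg, hprod, inv_one, ENNReal.ofReal_one]
  have hKm := measurable_impulseResponse lp lm
  simp_rw [ofReal_norm]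
  calc ∫⁻ t in Set.Ioi (0:ℝ), ‖dd t‖ₑ
    _ ≤ ∫⁻ t in Set.Ioi (0:ℝ), (‖a₀‖ₑ * impulseResponse lp lm t +
          ∫⁻ s in Set.Ioi 0, ‖f s‖ₑ * impulseResponse lp lm (t - s)) := by
      refine setLIntegral_mono' measurableSet_Ioi fun t ht ↦ ?_
      rw [hdd]
      exact enorm_duhamel_le hlt ht a₀ f
    _ ≤ ∫⁻ t, (‖a₀‖ₑ * impulseResponse lp lm t +
          ∫⁻ s in Set.Ioi 0, ‖f s‖ₑ * impulseResponse lp lm (t - s)) :=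
      setLIntegral_le_lintegral _ _
    _ = ‖a₀‖ₑ + ∫⁻ s in Set.Ioi 0, ‖f s‖ₑ := by
      rw [lintegral_add_left (hKm.const_mul _), lintegral_const_mul _ hKm,
        lintegral_setLIntegral_mul_comp_sub hf.aestronglyMeasurable.enorm hKm, hK, mul_one, mul_one]
    _ = ENNReal.ofReal (1 * (‖a₀‖ + ∫ s in Set.Ioi (0:ℝ), ‖f s‖)) := by
      rw [one_mul, ENNReal.ofReal_add (norm_nonneg _) (integral_nonneg fun _ ↦ norm_nonneg _),
        ofReal_norm, ofReal_integral_norm_eq_lintegral_enorm hf]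
end

section
/- There exists a universal constant C > 0 with the following property. Let b ≥ 3, let λ⁺ = (−b + √(b²−4))/2 and λ⁻ = (−b − √(b²−4))/2, let a₀ ∈ ℂ, and let f : [0,∞) → ℂ be continuous with ∫₀^∞ |f(s)| ds < ∞. Define d(t) := (λ⁺ − λ⁻)⁻¹ [ a₀ (e^{λ⁺t} − e^{λ⁻t}) + ∫₀ᵗ f(s)(e^{λ⁺(t−s)} − e^{λ⁻(t−s)}) ds ]. Then the derivative d' satisfies ∫₀^∞ |d'(t)| dt ≤ (C/b) ( |a₀| + ∫₀^∞ |f(s)| ds ), with C independent of b, a₀ and f. -/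
open MeasureTheory

/-- The Duhamel integral of `g` against the exponential kernel `exp (l * ·)`. -/
noncomputable def expDuhamel (l : ℝ) (g : ℝ → ℂ) (t : ℝ) : ℂ :=
  ∫ s in (0:ℝ)..t, g s * Complex.exp ((l : ℂ) * ((t - s : ℝ) : ℂ))

lemma hasDerivAt_cexp_mul_ofReal (l t : ℝ) :
    HasDerivAt (fun t : ℝ => Complex.exp ((l : ℂ) * (t : ℂ)))
      ((l : ℂ) * Complex.exp ((l : ℂ) * (t : ℂ))) t := by
  have h : HasDerivAt (fun t : ℝ => (l : ℂ) * (t : ℂ)) ((l : ℂ) * 1) t :=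
    (HasDerivAt.ofReal_comp (hasDerivAt_id t)).const_mul (l : ℂ)
  simpa [mul_comm] using h.cexp

lemma hasDerivAt_expDuhamel (l : ℝ) {g : ℝ → ℂ} (hg : Continuous g) (t : ℝ) :
    HasDerivAt (expDuhamel l g) ((l : ℂ) * expDuhamel l g t + g t) t := by
  have hfac : expDuhamel l g = fun t : ℝ => Complex.exp ((l : ℂ) * (t : ℂ)) *
      ∫ s in (0:ℝ)..t, g s * Complex.exp (-((l : ℂ) * (s : ℂ))) := by
    funext t
    rw [expDuhamel, ← intervalIntegral.integral_const_mul]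
    congr 1
    funext s
    rw [Complex.ofReal_sub, mul_sub, sub_eq_add_neg, Complex.exp_add]
    ring
  have hc : Continuous fun s : ℝ => g s * Complex.exp (-((l : ℂ) * (s : ℂ))) := by fun_prop
  have h := (hasDerivAt_cexp_mul_ofReal l t).mul
    (intervalIntegral.integral_hasDerivAt_right (hc.intervalIntegrable 0 t)
      (hc.stronglyMeasurableAtFilter _ _) hc.continuousAt)
  have he : Complex.exp ((l : ℂ) * (t : ℂ)) * Complex.exp (-((l : ℂ) * (t : ℂ))) = 1 := by
    rw [← Complex.exp_add, add_neg_cancel, Complex.exp_zero]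
  rw [hfac]
  refine h.congr_deriv ?_
  linear_combination g t * he

lemma lintegral_Ioi_exp_mul {l : ℝ} (hl : l < 0) :
    ∫⁻ t in Set.Ioi (0:ℝ), ENNReal.ofReal (Real.exp (l * t)) = ENNReal.ofReal (-l)⁻¹ := by
  rw [← ofReal_integral_eq_lintegral_ofReal (integrableOn_exp_mul_Ioi hl 0)
    (Filter.Eventually.of_forall fun t => (Real.exp_pos _).le), integral_exp_mul_Ioi hl]
  simp [neg_div, inv_neg]

lemma enorm_cexp_mul_ofReal (l t : ℝ) :
    ‖Complex.exp ((l : ℂ) * (t : ℂ))‖ₑ = ENNReal.ofReal (Real.exp (l * t)) := by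
  rw [← ofReal_norm, Complex.norm_exp]
  simp

/-- Young's inequality for the convolution with a decaying exponential on the half-line. -/
lemma lintegral_enorm_expDuhamel_le {l : ℝ} (hl : l < 0) {g : ℝ → ℂ} (hg : Continuous g) :
    ∫⁻ t in Set.Ioi (0:ℝ), ‖expDuhamel l g t‖ₑ ≤
      ENNReal.ofReal (-l)⁻¹ * ∫⁻ s in Set.Ioi (0:ℝ), ‖g s‖ₑ := by
  set E : ℝ → ENNReal :=
    (Set.Ici (0:ℝ)).indicator fun u => ENNReal.ofReal (Real.exp (l * u)) with hE
  have hEm : Measurable E :=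
    Measurable.indicator (by fun_prop) measurableSet_Ici
  have hEint : ∫⁻ u, E u = ENNReal.ofReal (-l)⁻¹ := by
    rw [hE, lintegral_indicator measurableSet_Ici, setLIntegral_congr Ioi_ae_eq_Ici.symm,
      lintegral_Ioi_exp_mul hl]
  have hpt : ∀ t ∈ Set.Ioi (0:ℝ),
      ‖expDuhamel l g t‖ₑ ≤ ∫⁻ s in Set.Ioi (0:ℝ), ‖g s‖ₑ * E (t - s) := by
    intro t ht
    rw [expDuhamel, intervalIntegral.integral_of_le (le_of_lt ht)]
    refine (enorm_integral_le_lintegral_enorm _).trans ?_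
    calc
      _ = ∫⁻ s in Set.Ioc 0 t, ‖g s‖ₑ * E (t - s) := by
        refine setLIntegral_congr_fun measurableSet_Ioc fun s hs => ?_
        have hmem : t - s ∈ Set.Ici (0:ℝ) := sub_nonneg.2 hs.2
        simp only [enorm_mul, enorm_cexp_mul_ofReal, hE, Set.indicator_of_mem hmem]
      _ ≤ _ := lintegral_mono_set Set.Ioc_subset_Ioi_self
  calc
    _ ≤ ∫⁻ t in Set.Ioi (0:ℝ), ∫⁻ s in Set.Ioi (0:ℝ), ‖g s‖ₑ * E (t - s) :=
      setLIntegral_mono' measurableSet_Ioi hpt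
    _ ≤ ∫⁻ t, ∫⁻ s in Set.Ioi (0:ℝ), ‖g s‖ₑ * E (t - s) := setLIntegral_le_lintegral _ _
    _ = ∫⁻ s in Set.Ioi (0:ℝ), ∫⁻ t, ‖g s‖ₑ * E (t - s) := by
      refine lintegral_lintegral_swap (Measurable.aemeasurable ?_)
      exact (hg.measurable.enorm.comp measurable_snd).mul
        (hEm.comp (measurable_fst.sub measurable_snd))
    _ = ∫⁻ s in Set.Ioi (0:ℝ), ENNReal.ofReal (-l)⁻¹ * ‖g s‖ₑ := by
      refine lintegral_congr fun s => ?_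
      rw [lintegral_const_mul _ (by fun_prop),
        lintegral_sub_right_eq_self E s, hEint, mul_comm]
    _ = _ := lintegral_const_mul _ hg.measurable.enorm

lemma lintegral_enorm_mul_add_expDuhamel_le {l : ℝ} (hl : l < 0) (a : ℂ) {g : ℝ → ℂ}
    (hg : Continuous g) :
    ∫⁻ t in Set.Ioi (0:ℝ),
        ‖(l : ℂ) * (a * Complex.exp ((l : ℂ) * (t : ℂ)) + expDuhamel l g t)‖ₑ ≤
      ‖a‖ₑ + ∫⁻ s in Set.Ioi (0:ℝ), ‖g s‖ₑ := by
  have hlE : ‖(l : ℂ)‖ₑ = ENNReal.ofReal (-l) := by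
    rw [← ofReal_norm, Complex.norm_real, Real.norm_of_nonpos hl.le]
  have hinv : ENNReal.ofReal (-l) * ENNReal.ofReal (-l)⁻¹ = 1 := by
    rw [← ENNReal.ofReal_mul (by linarith), mul_inv_cancel₀ (by linarith), ENNReal.ofReal_one]
  calc
    _ ≤ ∫⁻ t in Set.Ioi (0:ℝ), ENNReal.ofReal (-l) *
          (‖a‖ₑ * ENNReal.ofReal (Real.exp (l * t)) + ‖expDuhamel l g t‖ₑ) := by
      refine lintegral_mono fun t => ?_
      simp only [enorm_mul, hlE]
      gcongr
      refine (enorm_add_le _ _).trans ?_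
      rw [enorm_mul, enorm_cexp_mul_ofReal]
    _ = ENNReal.ofReal (-l) * (‖a‖ₑ * ENNReal.ofReal (-l)⁻¹ +
          ∫⁻ t in Set.Ioi (0:ℝ), ‖expDuhamel l g t‖ₑ) := by
      rw [lintegral_const_mul' _ _ ENNReal.ofReal_ne_top, lintegral_add_left (by fun_prop),
        lintegral_const_mul' _ _ enorm_ne_top, lintegral_Ioi_exp_mul hl]
    _ ≤ ENNReal.ofReal (-l) * (‖a‖ₑ * ENNReal.ofReal (-l)⁻¹ +
          ENNReal.ofReal (-l)⁻¹ * ∫⁻ s in Set.Ioi (0:ℝ), ‖g s‖ₑ) := by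
      gcongr
      exact lintegral_enorm_expDuhamel_le hl hg
    _ = (ENNReal.ofReal (-l) * ENNReal.ofReal (-l)⁻¹) *
          (‖a‖ₑ + ∫⁻ s in Set.Ioi (0:ℝ), ‖g s‖ₑ) := by ring
    _ = _ := by rw [hinv, one_mul]

/-- Mode-wise `L¹`-in-time estimate for the derivative: there is a universal
constant `C > 0` such that for every `b ≥ 3`, with `λ⁺ = (-b + √(b²-4))/2`,
`λ⁻ = (-b - √(b²-4))/2`, every `a₀ ∈ ℂ` and every continuous integrable
`f : [0,∞) → ℂ`, the derivative `d'` of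
`d(t) = (λ⁺-λ⁻)⁻¹ [a₀(e^{λ⁺t} - e^{λ⁻t}) + ∫₀ᵗ f(s)(e^{λ⁺(t-s)} - e^{λ⁻(t-s)}) ds]`
satisfies `∫₀^∞ |d'| ≤ (C/b) (|a₀| + ∫₀^∞ |f|)`. -/
theorem stmt_7 :
    ∃ C : ℝ, 0 < C ∧
      ∀ (b lp lm : ℝ), 3 ≤ b →
        lp = (-b + Real.sqrt (b ^ 2 - 4)) / 2 →
        lm = (-b - Real.sqrt (b ^ 2 - 4)) / 2 →
        ∀ (a₀ : ℂ) (f : ℝ → ℂ),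
          ContinuousOn f (Set.Ici 0) →
          IntegrableOn f (Set.Ioi 0) →
          ∀ dd : ℝ → ℂ,
            (∀ t : ℝ, dd t = (((lp - lm : ℝ)) : ℂ)⁻¹ *
              (a₀ * (Complex.exp ((lp : ℂ) * (t : ℂ)) - Complex.exp ((lm : ℂ) * (t : ℂ))) +
                ∫ s in (0:ℝ)..t,
                  f s * (Complex.exp ((lp : ℂ) * ((t - s : ℝ) : ℂ)) -
                         Complex.exp ((lm : ℂ) * ((t - s : ℝ) : ℂ))))) →
            ∀ d' : ℝ → ℂ,
              (∀ t ∈ Set.Ici (0:ℝ), HasDerivWithinAt dd (d' t) (Set.Ici 0) t) →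
              ∫⁻ t in Set.Ioi (0:ℝ), ENNReal.ofReal ‖d' t‖ ≤
                ENNReal.ofReal ((C / b) * (‖a₀‖ + ∫ s in Set.Ioi (0:ℝ), ‖f s‖)) := by
  refine ⟨3, by norm_num, ?_⟩
  intro b lp lm hb hlp hlm a₀ f hf hfi dd hdd d' hd'
  have hroot_pos : 0 < Real.sqrt (b ^ 2 - 4) := Real.sqrt_pos.2 (by nlinarith)
  have hroot_sq : Real.sqrt (b ^ 2 - 4) ^ 2 = b ^ 2 - 4 := Real.sq_sqrt (by nlinarith)
  have hdiff : lp - lm = Real.sqrt (b ^ 2 - 4) := by rw [hlp, hlm]; ring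
  have hlp_neg : lp < 0 := by rw [hlp]; nlinarith
  have hlm_neg : lm < 0 := by rw [hlm]; linarith
  have hgain : (lp - lm)⁻¹ * 2 ≤ 3 / b := by
    rw [hdiff, inv_mul_eq_div, div_le_div_iff₀ hroot_pos (by linarith)]
    nlinarith
  set g : ℝ → ℂ := fun s => f (max s 0) with hg_def
  have hg : Continuous g :=
    hf.comp_continuous (by fun_prop) fun s => le_max_right s 0
  have hgf : ∀ s, 0 ≤ s → g s = f s := fun s hs => by simp [hg_def, max_eq_left hs]
  set V : ℝ → ℝ → ℂ := fun l t =>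
    (l : ℂ) * (a₀ * Complex.exp ((l : ℂ) * (t : ℂ)) + expDuhamel l g t) with hV
  have hcont : ∀ l, Continuous (expDuhamel l g) := fun l =>
    continuous_iff_continuousAt.2 fun t => (hasDerivAt_expDuhamel l hg t).continuousAt
  have hdd_eq : ∀ t, 0 ≤ t → dd t = (((lp - lm : ℝ)) : ℂ)⁻¹ *
      ((a₀ * Complex.exp ((lp : ℂ) * (t : ℂ)) + expDuhamel lp g t) -
        (a₀ * Complex.exp ((lm : ℂ) * (t : ℂ)) + expDuhamel lm g t)) := by
    intro t ht
    have hsplit : ∫ s in (0:ℝ)..t, f s * (Complex.exp ((lp : ℂ) * ((t - s : ℝ) : ℂ)) -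
        Complex.exp ((lm : ℂ) * ((t - s : ℝ) : ℂ))) =
        expDuhamel lp g t - expDuhamel lm g t := by
      rw [expDuhamel, expDuhamel, ← intervalIntegral.integral_sub
        (Continuous.intervalIntegrable (by fun_prop) _ _)
        (Continuous.intervalIntegrable (by fun_prop) _ _)]
      refine intervalIntegral.integral_congr fun s hs => ?_
      rw [Set.uIcc_of_le ht] at hs
      simp only [hgf s hs.1, mul_sub]
    rw [hdd t, hsplit]
    ring
  have hd'_eq : ∀ t ∈ Set.Ioi (0:ℝ),
      d' t = (((lp - lm : ℝ)) : ℂ)⁻¹ * (V lp t - V lm t) := by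
    intro t ht
    have hsum : ∀ l : ℝ, HasDerivAt
        (fun t : ℝ => a₀ * Complex.exp ((l : ℂ) * (t : ℂ)) + expDuhamel l g t)
        (V l t + g t) t := fun l =>
      (((hasDerivAt_cexp_mul_ofReal l t).const_mul a₀).add
        (hasDerivAt_expDuhamel l hg t)).congr_deriv (by simp only [hV]; ring)
    have h1 := ((hsum lp).sub (hsum lm)).const_mul ((((lp - lm : ℝ)) : ℂ)⁻¹)
    have h2 : HasDerivAt dd (d' t) t := (hd' t (Set.Ioi_subset_Ici_self ht)).hasDerivAt (Ici_mem_nhds ht)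
    have h3 : HasDerivAt dd ((((lp - lm : ℝ)) : ℂ)⁻¹ * (V lp t + g t - (V lm t + g t))) t :=
      h1.congr_of_eventuallyEq (Filter.mem_of_superset (isOpen_Ioi.mem_nhds ht) fun s hs =>
        hdd_eq s (le_of_lt hs))
    rw [h2.unique h3]
    ring
  have hcE : ‖(((lp - lm : ℝ)) : ℂ)⁻¹‖ₑ = ENNReal.ofReal (lp - lm)⁻¹ := by
    rw [← ofReal_norm, norm_inv, Complex.norm_real,
      Real.norm_of_nonneg (by rw [hdiff]; exact hroot_pos.le)]
  have hfint : ∫⁻ s in Set.Ioi (0:ℝ), ‖g s‖ₑ =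
      ENNReal.ofReal (∫ s in Set.Ioi (0:ℝ), ‖f s‖) := by
    rw [ofReal_integral_norm_eq_lintegral_enorm hfi]
    exact setLIntegral_congr_fun measurableSet_Ioi fun s hs => by
      simp only [hgf s (le_of_lt hs)]
  have hnonneg : 0 ≤ ∫ s in Set.Ioi (0:ℝ), ‖f s‖ := integral_nonneg fun s => norm_nonneg _
  have hVm : Measurable fun t => ‖V lp t‖ₑ := by
    have := hcont lp
    simp only [hV]
    exact (Continuous.measurable (by fun_prop)).enorm
  calc
    _ ≤ ∫⁻ t in Set.Ioi (0:ℝ), ENNReal.ofReal (lp - lm)⁻¹ * (‖V lp t‖ₑ + ‖V lm t‖ₑ) := by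
      refine setLIntegral_mono' measurableSet_Ioi fun t ht => ?_
      rw [ofReal_norm, hd'_eq t ht, enorm_mul, hcE]
      gcongr
      exact enorm_sub_le
    _ = ENNReal.ofReal (lp - lm)⁻¹ * ((∫⁻ t in Set.Ioi (0:ℝ), ‖V lp t‖ₑ) +
          ∫⁻ t in Set.Ioi (0:ℝ), ‖V lm t‖ₑ) := by
      rw [lintegral_const_mul' _ _ ENNReal.ofReal_ne_top, lintegral_add_left hVm]
    _ ≤ ENNReal.ofReal (lp - lm)⁻¹ * ((‖a₀‖ₑ + ∫⁻ s in Set.Ioi (0:ℝ), ‖g s‖ₑ) +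
          (‖a₀‖ₑ + ∫⁻ s in Set.Ioi (0:ℝ), ‖g s‖ₑ)) := by
      gcongr
      · exact lintegral_enorm_mul_add_expDuhamel_le hlp_neg a₀ hg
      · exact lintegral_enorm_mul_add_expDuhamel_le hlm_neg a₀ hg
    _ = ENNReal.ofReal ((lp - lm)⁻¹ * 2 * (‖a₀‖ + ∫ s in Set.Ioi (0:ℝ), ‖f s‖)) := by
      have hsum_nonneg := add_nonneg (norm_nonneg a₀) hnonneg
      rw [hfint, ← ofReal_norm a₀, ← ENNReal.ofReal_add (norm_nonneg _) hnonneg,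
        ← ENNReal.ofReal_add hsum_nonneg hsum_nonneg,
        ← ENNReal.ofReal_mul (by rw [hdiff]; positivity)]
      congr 1
      ring
    _ ≤ _ := by gcongr
end

section
/- Let d ≥ 1 and T > 0. Let ρ : [0,T] × ℝᵈ → ℝ, v : [0,T] × ℝᵈ → ℝᵈ, and Ψ : [0,T] × ℝᵈ → ℝ be smooth functions, each (2π)-periodic in every spatial coordinate, and write Q := [0,2π]^d. Assume that on [0,T] × ℝᵈ they satisfy: (i) ∂ₜρ + div(ρ v) = 0; (ii) ρ(∂ₜv + (v·∇)v) − Δv = −ρ∇Ψ; (iii) −ΔΨ(t,·) = ρ(t,·) − (2π)^{−d}∫_Q ρ(t,x) dx and ∫_Q Ψ(t,x) dx = 0 for each t. Then for every t ∈ [0,T], (d/dt) [ (1/2) ∫_Q ρ(t,x)|v(t,x)|² dx + (1/2) ∫_Q |∇Ψ(t,x)|² dx ] = − ∫_Q |∇v(t,x)|² dx, where |∇v|² denotes the sum of squares of all first-order spatial partial derivatives of the components of v. -/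
open MeasureTheory

/-- Time partial derivative `∂ₜ f` of a function of `(t, x) ∈ ℝ × ℝᵈ`. -/
noncomputable def timeDeriv (d : ℕ) (f : ℝ × (Fin d → ℝ) → ℝ) (p : ℝ × (Fin d → ℝ)) : ℝ :=
  fderiv ℝ f p (1, 0)

/-- Spatial partial derivative `∂_{x_i} f` of a function of `(t, x) ∈ ℝ × ℝᵈ`. -/
noncomputable def spaceDeriv (d : ℕ) (i : Fin d) (f : ℝ × (Fin d → ℝ) → ℝ)
    (p : ℝ × (Fin d → ℝ)) : ℝ :=
  fderiv ℝ f p (0, Pi.single i 1)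

/-- The periodicity cube `Q = [0,2π]^d`. -/
def cube (d : ℕ) : Set (Fin d → ℝ) := Set.univ.pi fun _ => Set.Icc 0 (2 * Real.pi)

section Calculus

variable {d : ℕ} {f g : ℝ × (Fin d → ℝ) → ℝ}

lemma contDiff_timeDeriv (hf : ContDiff ℝ (⊤ : ℕ∞) f) :
    ContDiff ℝ (⊤ : ℕ∞) (timeDeriv d f) :=
  (hf.fderiv_right (m := (⊤ : ℕ∞)) (by simp)).clm_apply contDiff_const

lemma contDiff_spaceDeriv (hf : ContDiff ℝ (⊤ : ℕ∞) f) (i : Fin d) :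
    ContDiff ℝ (⊤ : ℕ∞) (spaceDeriv d i f) :=
  (hf.fderiv_right (m := (⊤ : ℕ∞)) (by simp)).clm_apply contDiff_const

lemma timeDeriv_mul (hf : ContDiff ℝ (⊤ : ℕ∞) f) (hg : ContDiff ℝ (⊤ : ℕ∞) g)
    (p : ℝ × (Fin d → ℝ)) :
    timeDeriv d (fun q => f q * g q) p = timeDeriv d f p * g p + f p * timeDeriv d g p := by
  have hf' := hf.differentiable (by simp) p
  have hg' := hg.differentiable (by simp) p
  simp only [timeDeriv, fderiv_fun_mul hf' hg', add_apply,
    smul_apply, smul_eq_mul]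
  ring

lemma spaceDeriv_mul (hf : ContDiff ℝ (⊤ : ℕ∞) f) (hg : ContDiff ℝ (⊤ : ℕ∞) g) (i : Fin d)
    (p : ℝ × (Fin d → ℝ)) :
    spaceDeriv d i (fun q => f q * g q) p =
      spaceDeriv d i f p * g p + f p * spaceDeriv d i g p := by
  have hf' := hf.differentiable (by simp) p
  have hg' := hg.differentiable (by simp) p
  simp only [spaceDeriv, fderiv_fun_mul hf' hg', add_apply,
    smul_apply, smul_eq_mul]
  ring

lemma timeDeriv_sum {ι : Type*} (s : Finset ι) {F : ι → ℝ × (Fin d → ℝ) → ℝ}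
    (hF : ∀ j, ContDiff ℝ (⊤ : ℕ∞) (F j)) (p : ℝ × (Fin d → ℝ)) :
    timeDeriv d (fun q => ∑ j ∈ s, F j q) p = ∑ j ∈ s, timeDeriv d (F j) p := by
  simp only [timeDeriv]
  rw [fderiv_fun_sum fun j _ => (hF j).differentiable (by simp) p, sum_apply]

lemma spaceDeriv_sum {ι : Type*} (s : Finset ι) {F : ι → ℝ × (Fin d → ℝ) → ℝ}
    (hF : ∀ j, ContDiff ℝ (⊤ : ℕ∞) (F j)) (i : Fin d) (p : ℝ × (Fin d → ℝ)) :
    spaceDeriv d i (fun q => ∑ j ∈ s, F j q) p = ∑ j ∈ s, spaceDeriv d i (F j) p := by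
  simp only [spaceDeriv]
  rw [fderiv_fun_sum fun j _ => (hF j).differentiable (by simp) p, sum_apply]

lemma timeDeriv_add (hf : ContDiff ℝ (⊤ : ℕ∞) f) (hg : ContDiff ℝ (⊤ : ℕ∞) g)
    (p : ℝ × (Fin d → ℝ)) :
    timeDeriv d (fun q => f q + g q) p = timeDeriv d f p + timeDeriv d g p := by
  simp only [timeDeriv]
  rw [fderiv_fun_add (hf.differentiable (by simp) p) (hg.differentiable (by simp) p),
    add_apply]

lemma spaceDeriv_add (hf : ContDiff ℝ (⊤ : ℕ∞) f) (hg : ContDiff ℝ (⊤ : ℕ∞) g) (i : Fin d)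
    (p : ℝ × (Fin d → ℝ)) :
    spaceDeriv d i (fun q => f q + g q) p = spaceDeriv d i f p + spaceDeriv d i g p := by
  simp only [spaceDeriv]
  rw [fderiv_fun_add (hf.differentiable (by simp) p) (hg.differentiable (by simp) p),
    add_apply]

/-- Mixed time-space derivatives of a smooth function commute. -/
lemma timeDeriv_spaceDeriv_comm (hf : ContDiff ℝ (⊤ : ℕ∞) f) (i : Fin d)
    (p : ℝ × (Fin d → ℝ)) :
    timeDeriv d (spaceDeriv d i f) p = spaceDeriv d i (timeDeriv d f) p := by
  have hd : DifferentiableAt ℝ (fderiv ℝ f) p :=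
    (hf.fderiv_right (m := (⊤ : ℕ∞)) (by simp)).differentiable (by simp) p
  have hs : IsSymmSndFDerivAt ℝ f p :=
    hf.contDiffAt.isSymmSndFDerivAt (by
      rw [minSmoothness_of_isRCLikeNormedField]
      exact WithTop.coe_le_coe.2 (le_top : (2 : ℕ∞) ≤ ⊤))
  have key (u w : ℝ × (Fin d → ℝ)) :
      fderiv ℝ (fun q => fderiv ℝ f q u) p w = fderiv ℝ (fderiv ℝ f) p w u := by
    rw [fderiv_clm_apply hd (differentiableAt_const u)]
    simp
  have h := hs.eq (1, 0) (0, Pi.single i 1)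
  rw [← key, ← key] at h
  exact h

lemma hasDerivAt_timeDeriv (hf : ContDiff ℝ (⊤ : ℕ∞) f) (t : ℝ) (x : Fin d → ℝ) :
    HasDerivAt (fun τ => f (τ, x)) (timeDeriv d f (t, x)) t :=
  (hf.differentiable (by simp) (t, x)).hasFDerivAt.comp_hasDerivAt t
    ((hasDerivAt_id t).prodMk (hasDerivAt_const t x))

/-- Time derivatives agree along two spatial points, endpoints included, when the functions agree
along them on a nondegenerate time interval. -/
lemma timeDeriv_eq_of_eqOn_Icc (hf : ContDiff ℝ (⊤ : ℕ∞) f) {T : ℝ} (hT : 0 < T)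
    {x y : Fin d → ℝ} (h : ∀ τ ∈ Set.Icc 0 T, f (τ, x) = f (τ, y)) {t : ℝ}
    (ht : t ∈ Set.Icc 0 T) : timeDeriv d f (t, x) = timeDeriv d f (t, y) :=
  (uniqueDiffOn_Icc hT t ht).eq_deriv _ (hasDerivAt_timeDeriv hf t x).hasDerivWithinAt
    ((hasDerivAt_timeDeriv hf t y).hasDerivWithinAt.congr h (h t ht))

lemma fderiv_periodic {a : ℝ × (Fin d → ℝ)} (h : ∀ p, f (p + a) = f p)
    (p : ℝ × (Fin d → ℝ)) : fderiv ℝ f (p + a) = fderiv ℝ f p := by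
  rw [← fderiv_comp_add_right]
  simp only [h]

lemma timeDeriv_periodic {a : Fin d → ℝ} (h : ∀ t x, f (t, x + a) = f (t, x)) (t : ℝ)
    (x : Fin d → ℝ) : timeDeriv d f (t, x + a) = timeDeriv d f (t, x) := by
  have := fderiv_periodic (f := f) (a := (0, a)) (fun ⟨s, y⟩ => by simpa using h s y) (t, x)
  simp only [Prod.mk_add_mk, add_zero] at this
  simp only [timeDeriv, this]

lemma spaceDeriv_periodic {a : Fin d → ℝ} (h : ∀ t x, f (t, x + a) = f (t, x)) (i : Fin d)
    (t : ℝ) (x : Fin d → ℝ) : spaceDeriv d i f (t, x + a) = spaceDeriv d i f (t, x) := by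
  have := fderiv_periodic (f := f) (a := (0, a)) (fun ⟨s, y⟩ => by simpa using h s y) (t, x)
  simp only [Prod.mk_add_mk, add_zero] at this
  simp only [spaceDeriv, this]

lemma isCompact_cube : IsCompact (cube d) := isCompact_univ_pi fun _ => isCompact_Icc

lemma cube_eq_Icc : cube d = Set.Icc 0 (fun _ => 2 * Real.pi) := by
  simp [cube, ← Set.pi_univ_Icc]

lemma integrableOn_cube (hf : Continuous f) (t : ℝ) :
    IntegrableOn (fun x => f (t, x)) (cube d) :=
  (hf.comp (by fun_prop)).continuousOn.integrableOn_compact isCompact_cube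

/-- Differentiation under the integral over the periodicity cube. -/
lemma hasDerivAt_integral_cube (hf : ContDiff ℝ (⊤ : ℕ∞) f) (t : ℝ) :
    HasDerivAt (fun τ => ∫ x in cube d, f (τ, x)) (∫ x in cube d, timeDeriv d f (t, x)) t := by
  have hc : Continuous (timeDeriv d f) := (contDiff_timeDeriv hf).continuous
  obtain ⟨C, hC⟩ := ((isCompact_closedBall t 1).prod (isCompact_cube (d := d)))
    |>.exists_bound_of_continuousOn hc.continuousOn
  have : IsFiniteMeasure (volume.restrict (cube d)) :=
    isFiniteMeasure_restrict.2 isCompact_cube.measure_lt_top.ne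
  refine (hasDerivAt_integral_of_dominated_loc_of_deriv_le (bound := fun _ => C)
    (μ := volume.restrict (cube d)) (F := fun τ x => f (τ, x))
    (F' := fun τ x => timeDeriv d f (τ, x))
    (Metric.closedBall_mem_nhds t one_pos) (.of_forall fun τ => ?_)
    (integrableOn_cube hf.continuous t) (integrableOn_cube hc t).aestronglyMeasurable
    ?_ (integrable_const C) (.of_forall fun x τ _ => hasDerivAt_timeDeriv hf τ x)).2
  · exact (integrableOn_cube hf.continuous τ).aestronglyMeasurable
  · refine ae_restrict_of_forall_mem isCompact_cube.measurableSet fun x hx τ hτ => ?_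
    exact hC (τ, x) ⟨hτ, hx⟩

/-- The divergence of a smooth periodic vector field has zero mean. -/
lemma integral_cube_divergence_eq_zero {F : Fin d → ℝ × (Fin d → ℝ) → ℝ}
    (hF : ∀ i, ContDiff ℝ (⊤ : ℕ∞) (F i))
    (hper : ∀ i t x, F i (t, x + Pi.single i (2 * Real.pi)) = F i (t, x)) (t : ℝ) :
    ∫ x in cube d, ∑ i, spaceDeriv d i (F i) (t, x) = 0 := by
  cases d with
  | zero => simp
  | succ n =>
    have hint : IntegrableOn (fun x => ∑ i, spaceDeriv (n + 1) i (F i) (t, x)) (cube (n + 1)) :=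
      integrable_finsetSum _ fun i _ => integrableOn_cube (contDiff_spaceDeriv (hF i) i).continuous t
    rw [cube_eq_Icc] at hint ⊢
    have hle : (0 : Fin (n + 1) → ℝ) ≤ fun _ => 2 * Real.pi := fun _ => Real.two_pi_pos.le
    have h := integral_divergence_of_hasFDerivAt_off_countable' 0 (fun _ => 2 * Real.pi) hle
      (fun i x => F i (t, x))
      (fun i x => (fderiv ℝ (F i) (t, x)).comp (.inr ℝ ℝ (Fin (n + 1) → ℝ))) ∅
      Set.countable_empty
      (fun i => ((hF i).continuous.comp (by fun_prop)).continuousOn)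
      (fun x _ i => ((hF i).differentiable (by simp) (t, x)).hasFDerivAt.comp x
        (hasFDerivAt_prodMk_right t x))
      (by simpa [spaceDeriv] using hint)
    simp only [ContinuousLinearMap.comp_apply, ContinuousLinearMap.inr_apply] at h
    refine h.trans (Finset.sum_eq_zero fun i _ => sub_eq_zero.2 ?_)
    congr 1 with y
    rw [← hper i t (i.insertNth ((0 : Fin (n + 1) → ℝ) i) y)]
    congr 2
    ext j
    refine i.succAboveCases ?_ (fun k => ?_) j <;> simp

end Calculus

/-- The pointwise energy balance: the time derivative of the energy density is a divergence minus
the dissipation and a multiple of the potential. Here `G i` stands for `∂ᵢ(ρvᵢ)`, `A i j` for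
`∂ᵢvⱼ`, `L i j` for `∂ᵢ²vⱼ`, and `M i`, `N i` for `∂ₜ∂ᵢΨ`, `∂ᵢ∂ₜ∂ᵢΨ`. -/
lemma energy_balance {ι : Type*} [Fintype ι] (r rt P c : ℝ) (a vt G dP M N : ι → ℝ)
    (A L : ι → ι → ℝ) (hmass : rt + ∑ i, G i = 0)
    (hmom : ∀ j, r * (vt j + ∑ i, a i * A i j) - ∑ i, L i j = -(r * dP j))
    (hpoisson : ∑ i, N i + rt = c) :
    (1 / 2) * (rt * ∑ j, a j ^ 2 + r * ∑ j, (vt j * a j + a j * vt j)) +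
        (1 / 2) * ∑ i, (M i * dP i + dP i * M i) =
      ∑ i, ((-1 / 2) * (G i * ∑ j, a j ^ 2 + r * a i * ∑ j, (A i j * a j + a j * A i j)) +
          ∑ j, (A i j * A i j + a j * L i j) + (dP i * M i + P * N i) +
          (-1) * (dP i * (r * a i) + P * G i)) -
        ∑ i, ∑ j, A i j ^ 2 - c * P := by
  have hm : ∑ j, a j * (r * (vt j + ∑ i, a i * A i j) - ∑ i, L i j) =
      ∑ j, a j * (-(r * dP j)) := by simp only [hmom]
  have e1 : ∑ j, a j * (r * (vt j + ∑ i, a i * A i j) - ∑ i, L i j) =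
      r * ∑ j, a j * vt j + r * ∑ i, a i * ∑ j, a j * A i j - ∑ i, ∑ j, a j * L i j := by
    rw [Finset.sum_comm (f := fun i j => a j * L i j)]
    simp only [Finset.mul_sum, mul_sub, mul_add, Finset.sum_sub_distrib, Finset.sum_add_distrib]
    rw [Finset.sum_comm (f := fun i j => r * (a i * (a j * A i j)))]
    congr 2
    · exact Finset.sum_congr rfl fun j _ => by ring
    · exact Finset.sum_congr rfl fun j _ => Finset.sum_congr rfl fun i _ => by ring
  have e2 : ∑ j, a j * (-(r * dP j)) = -∑ i, dP i * (r * a i) := by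
    rw [← Finset.sum_neg_distrib]
    exact Finset.sum_congr rfl fun j _ => by ring
  have e3 : ∑ j, (vt j * a j + a j * vt j) = 2 * ∑ j, a j * vt j := by
    rw [Finset.mul_sum]
    exact Finset.sum_congr rfl fun j _ => by ring
  have e4 : ∑ i, (M i * dP i + dP i * M i) = 2 * ∑ i, dP i * M i := by
    rw [Finset.mul_sum]
    exact Finset.sum_congr rfl fun j _ => by ring
  have e5 (i : ι) : ∑ j, (A i j * a j + a j * A i j) = 2 * ∑ j, a j * A i j := by
    rw [Finset.mul_sum]
    exact Finset.sum_congr rfl fun j _ => by ring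
  have e6 : ∑ i, r * a i * (2 * ∑ j, a j * A i j) = 2 * (r * ∑ i, a i * ∑ j, a j * A i j) := by
    simp only [Finset.mul_sum]
    exact Finset.sum_congr rfl fun j _ => Finset.sum_congr rfl fun i _ => by ring
  rw [e3, e4]
  simp only [e5, Finset.sum_add_distrib, ← Finset.mul_sum, ← Finset.sum_mul, ← pow_two, e6]
  rw [e1, e2] at hm
  have hG : ∑ i, G i = -rt := by linarith
  have hN : ∑ i, N i = c - rt := by linarith
  rw [hG, hN]
  linear_combination hm

/-- Energy dissipation identity for the pressureless hydrodynamic model: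
if `∂ₜρ + div(ρv) = 0`, `ρ(∂ₜv + v·∇v) - Δv = -ρ∇Ψ`,
`-ΔΨ = ρ - (2π)^{-d}∫_Q ρ` and `∫_Q Ψ = 0` on `[0,T] × ℝᵈ` (all functions
smooth and `2π`-periodic in each spatial coordinate), then
`(d/dt)[½∫_Q ρ|v|² + ½∫_Q |∇Ψ|²] = -∫_Q |∇v|²` on `[0,T]`. -/
theorem stmt_11 (d : ℕ) (hd : 1 ≤ d) (T : ℝ) (hT : 0 < T)
    (ρ Ψ : ℝ × (Fin d → ℝ) → ℝ) (v : ℝ × (Fin d → ℝ) → Fin d → ℝ)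
    (hρ : ContDiff ℝ (⊤ : ℕ∞) ρ) (hv : ContDiff ℝ (⊤ : ℕ∞) v) (hΨ : ContDiff ℝ (⊤ : ℕ∞) Ψ)
    (hρper : ∀ t x (i : Fin d), ρ (t, x + Pi.single i (2 * Real.pi)) = ρ (t, x))
    (hvper : ∀ t x (i : Fin d), v (t, x + Pi.single i (2 * Real.pi)) = v (t, x))
    (hΨper : ∀ t x (i : Fin d), Ψ (t, x + Pi.single i (2 * Real.pi)) = Ψ (t, x))
    (hmass : ∀ t ∈ Set.Icc 0 T, ∀ x,
      timeDeriv d ρ (t, x) + ∑ i, spaceDeriv d i (fun p => ρ p * v p i) (t, x) = 0)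
    (hmom : ∀ t ∈ Set.Icc 0 T, ∀ x, ∀ j : Fin d,
      ρ (t, x) * (timeDeriv d (fun p => v p j) (t, x) +
          ∑ i, v (t, x) i * spaceDeriv d i (fun p => v p j) (t, x)) -
        ∑ i, spaceDeriv d i (spaceDeriv d i fun p => v p j) (t, x) =
      -(ρ (t, x) * spaceDeriv d j Ψ (t, x)))
    (hpoisson : ∀ t ∈ Set.Icc 0 T, ∀ x,
      -∑ i, spaceDeriv d i (spaceDeriv d i Ψ) (t, x) =
        ρ (t, x) - ((2 * Real.pi) ^ d)⁻¹ * ∫ y in cube d, ρ (t, y))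
    (hΨmean : ∀ t ∈ Set.Icc 0 T, (∫ y in cube d, Ψ (t, y)) = 0) :
    ∀ t ∈ Set.Icc 0 T,
      HasDerivAt
        (fun τ => (1 / 2) * (∫ x in cube d, ρ (τ, x) * ∑ j, v (τ, x) j ^ 2) +
          (1 / 2) * ∫ x in cube d, ∑ i, spaceDeriv d i Ψ (τ, x) ^ 2)
        (-∫ x in cube d, ∑ i, ∑ j, spaceDeriv d i (fun p => v p j) (t, x) ^ 2) t := by
  intro t ht
  have hvj (j : Fin d) : ContDiff ℝ (⊤ : ℕ∞) fun p => v p j := contDiff_pi.1 hv j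
  have hdv (i j : Fin d) := contDiff_spaceDeriv (hvj j) i
  have hdΨ (i : Fin d) := contDiff_spaceDeriv hΨ i
  have htdΨ (i : Fin d) := contDiff_timeDeriv (hdΨ i)
  have hρv (i : Fin d) : ContDiff ℝ (⊤ : ℕ∞) fun p => ρ p * v p i := hρ.mul (hvj i)
  have hvv (j : Fin d) : ContDiff ℝ (⊤ : ℕ∞) fun p => v p j * v p j := (hvj j).mul (hvj j)
  have hs : ContDiff ℝ (⊤ : ℕ∞) fun p => ∑ j, v p j * v p j := ContDiff.sum fun j _ => hvv j
  have hvdv (i j : Fin d) : ContDiff ℝ (⊤ : ℕ∞) fun p =>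
      v p j * spaceDeriv d i (fun q => v q j) p := (hvj j).mul (hdv i j)
  have hsq (i : Fin d) : ContDiff ℝ (⊤ : ℕ∞) fun p => spaceDeriv d i Ψ p * spaceDeriv d i Ψ p :=
    (hdΨ i).mul (hdΨ i)
  have hkin : ContDiff ℝ (⊤ : ℕ∞) fun p => ρ p * ∑ j, v p j * v p j := hρ.mul hs
  have hpot : ContDiff ℝ (⊤ : ℕ∞) fun p => ∑ i, spaceDeriv d i Ψ p * spaceDeriv d i Ψ p :=
    ContDiff.sum fun i _ => hsq i
  have hH : ContDiff ℝ (⊤ : ℕ∞) fun p => ∑ i, spaceDeriv d i (spaceDeriv d i Ψ) p :=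
    ContDiff.sum fun i _ => contDiff_spaceDeriv (hdΨ i) i
  obtain ⟨c, hc⟩ : ∃ c, ∀ x, ∑ i, spaceDeriv d i (timeDeriv d (spaceDeriv d i Ψ)) (t, x) +
      timeDeriv d ρ (t, x) = c := by
    have key (x : Fin d → ℝ) :
        ∑ i, spaceDeriv d i (timeDeriv d (spaceDeriv d i Ψ)) (t, x) + timeDeriv d ρ (t, x) =
        timeDeriv d (fun p => ∑ i, spaceDeriv d i (spaceDeriv d i Ψ) p + ρ p) (t, x) := by
      rw [timeDeriv_add hH hρ, timeDeriv_sum _ fun i => contDiff_spaceDeriv (hdΨ i) i]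
      simp only [timeDeriv_spaceDeriv_comm (hdΨ _)]
    refine ⟨_, fun x => (key x).trans
      (timeDeriv_eq_of_eqOn_Icc (hH.add hρ) hT (y := 0) (fun τ hτ => ?_) ht)⟩
    linarith [hpoisson τ hτ x, hpoisson τ hτ 0]
  let F (i : Fin d) (p : ℝ × (Fin d → ℝ)) : ℝ :=
    (-1 / 2) * (ρ p * v p i * ∑ j, v p j * v p j) +
      ∑ j, v p j * spaceDeriv d i (fun q => v q j) p +
      Ψ p * timeDeriv d (spaceDeriv d i Ψ) p + (-1) * (Ψ p * (ρ p * v p i))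
  have hF1 (i : Fin d) : ContDiff ℝ (⊤ : ℕ∞) fun p => ρ p * v p i * ∑ j, v p j * v p j :=
    (hρv i).mul hs
  have hF1' (i : Fin d) : ContDiff ℝ (⊤ : ℕ∞) fun p =>
      (-1 / 2) * (ρ p * v p i * ∑ j, v p j * v p j) := contDiff_const.mul (hF1 i)
  have hF2 (i : Fin d) : ContDiff ℝ (⊤ : ℕ∞) fun p =>
      ∑ j, v p j * spaceDeriv d i (fun q => v q j) p := ContDiff.sum fun j _ => hvdv i j
  have hF3 (i : Fin d) : ContDiff ℝ (⊤ : ℕ∞) fun p => Ψ p * timeDeriv d (spaceDeriv d i Ψ) p :=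
    hΨ.mul (htdΨ i)
  have hF4 (i : Fin d) : ContDiff ℝ (⊤ : ℕ∞) fun p => Ψ p * (ρ p * v p i) := hΨ.mul (hρv i)
  have hF4' (i : Fin d) : ContDiff ℝ (⊤ : ℕ∞) fun p => (-1) * (Ψ p * (ρ p * v p i)) :=
    contDiff_const.mul (hF4 i)
  have hF (i : Fin d) : ContDiff ℝ (⊤ : ℕ∞) (F i) :=
    (((hF1' i).add (hF2 i)).add (hF3 i)).add (hF4' i)
  have hFper (i : Fin d) (s : ℝ) (x : Fin d → ℝ) :
      F i (s, x + Pi.single i (2 * Real.pi)) = F i (s, x) := by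
    have h1 (j : Fin d) := spaceDeriv_periodic (f := fun q => v q j)
      (fun s x => congrFun (hvper s x i) j) i s x
    have h2 := timeDeriv_periodic
      (spaceDeriv_periodic (fun s x => hΨper s x i) i) s x
    simp only [F, hρper, hvper, hΨper, h1, h2]
  have hconst (i : Fin d) (k : ℝ) (p : ℝ × (Fin d → ℝ)) : spaceDeriv d i (fun _ => k) p = 0 := by
    simp [spaceDeriv]
  have hbal (x : Fin d → ℝ) :
      (1 / 2) * timeDeriv d (fun p => ρ p * ∑ j, v p j * v p j) (t, x) +
        (1 / 2) * timeDeriv d (fun p => ∑ i, spaceDeriv d i Ψ p * spaceDeriv d i Ψ p) (t, x) =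
      ∑ i, spaceDeriv d i (F i) (t, x) -
        ∑ i, ∑ j, spaceDeriv d i (fun p => v p j) (t, x) ^ 2 - c * Ψ (t, x) := by
    have hFd (i : Fin d) : spaceDeriv d i (F i) (t, x) =
        (-1 / 2) * (spaceDeriv d i (fun p => ρ p * v p i) (t, x) * ∑ j, v (t, x) j ^ 2 +
            ρ (t, x) * v (t, x) i * ∑ j, (spaceDeriv d i (fun p => v p j) (t, x) * v (t, x) j +
              v (t, x) j * spaceDeriv d i (fun p => v p j) (t, x))) +
          ∑ j, (spaceDeriv d i (fun p => v p j) (t, x) * spaceDeriv d i (fun p => v p j) (t, x) +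
            v (t, x) j * spaceDeriv d i (spaceDeriv d i fun p => v p j) (t, x)) +
          (spaceDeriv d i Ψ (t, x) * timeDeriv d (spaceDeriv d i Ψ) (t, x) +
            Ψ (t, x) * spaceDeriv d i (timeDeriv d (spaceDeriv d i Ψ)) (t, x)) +
          (-1) * (spaceDeriv d i Ψ (t, x) * (ρ (t, x) * v (t, x) i) +
            Ψ (t, x) * spaceDeriv d i (fun p => ρ p * v p i) (t, x)) := by
      simp only [F]
      rw [spaceDeriv_add (((hF1' i).add (hF2 i)).add (hF3 i)) (hF4' i),
        spaceDeriv_add ((hF1' i).add (hF2 i)) (hF3 i), spaceDeriv_add (hF1' i) (hF2 i),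
        spaceDeriv_mul contDiff_const (hF1 i), spaceDeriv_mul contDiff_const (hF4 i),
        spaceDeriv_mul (hρv i) hs, spaceDeriv_mul hΨ (hρv i), spaceDeriv_mul hΨ (htdΨ i),
        spaceDeriv_sum _ hvv, spaceDeriv_sum _ (hvdv i)]
      simp only [spaceDeriv_mul (hvj _) (hvj _), spaceDeriv_mul (hvj _) (hdv i _), hconst,
        zero_mul, zero_add, pow_two]
    rw [timeDeriv_mul hρ hs, timeDeriv_sum _ hvv, timeDeriv_sum _ hsq]
    simp only [hFd, timeDeriv_mul (hvj _) (hvj _), timeDeriv_mul (hdΨ _) (hdΨ _)]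
    simp only [← pow_two (v _ _)]
    exact energy_balance _ _ _ _ _ _ _ _ _ _ _ _ (hmass t ht x) (hmom t ht x) (hc x)
  have hD := ((hasDerivAt_integral_cube hkin t).const_mul (1 / 2)).add
    ((hasDerivAt_integral_cube hpot t).const_mul (1 / 2))
  simp only [pow_two (v _ _), pow_two (spaceDeriv d _ Ψ _)]
  refine hD.congr_deriv ?_
  rw [← integral_const_mul, ← integral_const_mul, ← integral_add
    ((integrableOn_cube (contDiff_timeDeriv hkin).continuous t).const_mul _)
    ((integrableOn_cube (contDiff_timeDeriv hpot).continuous t).const_mul _)]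
  simp only [hbal]
  have hi1 : IntegrableOn (fun x => ∑ i, spaceDeriv d i (F i) (t, x)) (cube d) :=
    integrable_finsetSum _ fun i _ => integrableOn_cube (contDiff_spaceDeriv (hF i) i).continuous t
  have hi2 : IntegrableOn
      (fun x => ∑ i, ∑ j, spaceDeriv d i (fun p => v p j) (t, x) ^ 2) (cube d) :=
    integrable_finsetSum _ fun i _ => integrable_finsetSum _ fun j _ =>
      integrableOn_cube ((hdv i j).pow 2).continuous t
  have hi12 : IntegrableOn (fun x => ∑ i, spaceDeriv d i (F i) (t, x) -
      ∑ i, ∑ j, spaceDeriv d i (fun p => v p j) (t, x) ^ 2) (cube d) := hi1.sub hi2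
  rw [integral_sub hi12 ((integrableOn_cube hΨ.continuous t).const_mul c),
    integral_sub hi1 hi2, integral_const_mul, hΨmean t ht,
    integral_cube_divergence_eq_zero hF hFper]
  ring
end
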